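/- Let p₁ > 4/d and let g₁, g₂ : [0,∞) → ℝ be continuous with g₁(0) = g₂(0) = 0, continuously differentiable on (0,∞), and satisfying |gⱼ'(λ)| ≤ C(λ^{2/d} + λ^{p₁/2}) for all λ > 0, j ∈ {1,2}, and some constant C. Define hⱼ(k) = e^{-k} gⱼ'(e^{-k}) for k ∈ ℝ. If for every a ∈ ℝ the (absolutely convergent) integral satisfies ∫_{-a}^∞ (h₁(k) − h₂(k)) μ(e^{-(k+a)}) dk = 0, then g₁(λ) = g₂(λ) for every λ ∈ [0,∞). -/

import Mathlib

open MeasureTheory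
open scoped BigOperators

/-- The Gaussian space-time weight `w(t,x) = (1+t²)^{-d/2} exp(-|x|²/(2(1+t²)))`. -/
noncomputable def gaussWeight (d : ℕ) (p : ℝ × (Fin d → ℝ)) : ℝ :=
  (1 + p.1 ^ 2) ^ (-(d : ℝ) / 2) *
    Real.exp (-(∑ j, p.2 j ^ 2) / (2 * (1 + p.1 ^ 2)))

/-- The distribution function `μ(λ) = |{(t,x) : w(t,x) > λ}|`. -/
noncomputable def gaussDist (d : ℕ) (l : ℝ) : ℝ :=
  (volume {p : ℝ × (Fin d → ℝ) | l < gaussWeight d p}).toReal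

/-- The one-sided power kernel `s ↦ s₊ ^ a`, vanishing for `s ≤ 0`. -/
noncomputable def truncPow (a s : ℝ) : ℝ := (Set.Ioi (0 : ℝ)).indicator (fun x => x ^ a) s

theorem truncPow_of_pos {a s : ℝ} (hs : 0 < s) : truncPow a s = s ^ a :=
  Set.indicator_of_mem (Set.mem_Ioi.2 hs) _

theorem truncPow_of_nonpos {a s : ℝ} (hs : s ≤ 0) : truncPow a s = 0 :=
  Set.indicator_of_notMem (Set.notMem_Ioi.2 hs) _

theorem truncPow_nonneg (a s : ℝ) : 0 ≤ truncPow a s :=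
  Set.indicator_nonneg (fun _ hx => Real.rpow_nonneg (le_of_lt hx) _) _

@[fun_prop]
theorem measurable_truncPow (a : ℝ) : Measurable (truncPow a) :=
  (measurable_id.pow_const a).indicator measurableSet_Ioi

theorem truncPow_mul {a c : ℝ} (hc : 0 < c) (s : ℝ) :
    truncPow a (c * s) = c ^ a * truncPow a s := by
  rcases le_or_gt s 0 with hs | hs
  · rw [truncPow_of_nonpos hs, truncPow_of_nonpos (mul_nonpos_of_nonneg_of_nonpos hc.le hs),
      mul_zero]
  · rw [truncPow_of_pos hs, truncPow_of_pos (mul_pos hc hs), Real.mul_rpow hc.le hs.le]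

theorem truncPow_mul_truncPow_one_sub {a b : ℝ} (ha : -1 < a) (hb : -1 < b) (v : ℝ) :
    truncPow a v * truncPow b (1 - v) =
      ProbabilityTheory.beta (a + 1) (b + 1) *
        ProbabilityTheory.betaPDFReal (a + 1) (b + 1) v := by
  have h0 : ProbabilityTheory.beta (a + 1) (b + 1) ≠ 0 :=
    (ProbabilityTheory.beta_pos (by linarith) (by linarith)).ne'
  unfold ProbabilityTheory.betaPDFReal
  split_ifs with h
  · rw [truncPow_of_pos h.1, truncPow_of_pos (by linarith [h.2])]
    simp only [add_sub_cancel_right]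
    field_simp
  · rcases le_or_gt v 0 with hv | hv
    · simp [truncPow_of_nonpos hv]
    · rw [truncPow_of_nonpos (s := 1 - v) (by by_contra! h1; exact h ⟨hv, by linarith⟩)]
      simp

theorem integrable_betaPDFReal {a b : ℝ} (ha : 0 < a) (hb : 0 < b) :
    Integrable (ProbabilityTheory.betaPDFReal a b) := by
  refine ⟨(ProbabilityTheory.measurable_betaPDFReal a b).aestronglyMeasurable, ?_⟩
  rw [hasFiniteIntegral_iff_ofReal]
  · exact (ProbabilityTheory.lintegral_betaPDF_eq_one ha hb).trans_lt ENNReal.one_lt_top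
  · refine .of_forall fun v => ?_
    by_cases h : 0 < v ∧ v < 1
    · exact (ProbabilityTheory.betaPDFReal_pos h.1 h.2 ha hb).le
    · simp [ProbabilityTheory.betaPDFReal, h]

theorem integral_betaPDFReal {a b : ℝ} (ha : 0 < a) (hb : 0 < b) :
    ∫ v, ProbabilityTheory.betaPDFReal a b v = 1 := by
  rw [integral_eq_lintegral_of_nonneg_ae]
  · exact (ENNReal.toReal_eq_one_iff _).2 (ProbabilityTheory.lintegral_betaPDF_eq_one ha hb)
  · refine .of_forall fun v => ?_
    by_cases h : 0 < v ∧ v < 1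
    · exact (ProbabilityTheory.betaPDFReal_pos h.1 h.2 ha hb).le
    · simp [ProbabilityTheory.betaPDFReal, h]
  · exact (ProbabilityTheory.measurable_betaPDFReal a b).aestronglyMeasurable

theorem truncPow_convolution {a b : ℝ} (ha : -1 < a) (hb : -1 < b) (x : ℝ) :
    Integrable (fun t => truncPow a t * truncPow b (x - t)) ∧
      ∫ t, truncPow a t * truncPow b (x - t) =
        ProbabilityTheory.beta (a + 1) (b + 1) * truncPow (a + b + 1) x := by
  rcases le_or_gt x 0 with hx | hx
  · have : (fun t => truncPow a t * truncPow b (x - t)) = fun _ => 0 := by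
      ext t
      rcases le_or_gt t 0 with ht | ht
      · simp [truncPow_of_nonpos ht]
      · simp [truncPow_of_nonpos (show x - t ≤ 0 by linarith)]
    rw [this]
    simp [truncPow_of_nonpos hx]
  · have key : ∀ v, truncPow a (x * v) * truncPow b (x - x * v) = x ^ (a + b) *
        (ProbabilityTheory.beta (a + 1) (b + 1) *
          ProbabilityTheory.betaPDFReal (a + 1) (b + 1) v) := by
      intro v
      rw [← truncPow_mul_truncPow_one_sub ha hb, show x - x * v = x * (1 - v) by ring,
        truncPow_mul hx, truncPow_mul hx, Real.rpow_add hx]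
      ring
    constructor
    · rw [← integrable_comp_mul_left_iff _ hx.ne']
      simp_rw [key]
      exact ((integrable_betaPDFReal (by linarith) (by linarith)).const_mul _).const_mul _
    · have h := Measure.integral_comp_mul_left
        (fun t => truncPow a t * truncPow b (x - t)) x
      simp_rw [key] at h
      rw [integral_const_mul, integral_const_mul,
        integral_betaPDFReal (by linarith) (by linarith), abs_of_pos (inv_pos.2 hx),
        smul_eq_mul] at h
      rw [truncPow_of_pos hx, Real.rpow_add hx, Real.rpow_one]
      field_simp at h
      linarith

/-- The semigroup law of one-sided fractional integrals, with the integrability it needs. -/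
theorem integral_truncPow_comp {F : ℝ → ℝ} (hF : AEStronglyMeasurable F) {a b : ℝ}
    (ha : -1 < a) (hb : -1 < b) (r : ℝ)
    (hFi : Integrable (fun u => F u * truncPow (a + b + 1) (r - u))) :
    Integrable (fun v => (∫ u, F u * truncPow a (v - u)) * truncPow b (r - v)) ∧
      ∫ v, (∫ u, F u * truncPow a (v - u)) * truncPow b (r - v) =
        ProbabilityTheory.beta (a + 1) (b + 1) *
          ∫ u, F u * truncPow (a + b + 1) (r - u) := by
  have hsec : ∀ u, Integrable (fun v => truncPow a (v - u) * truncPow b (r - v)) ∧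
      ∫ v, truncPow a (v - u) * truncPow b (r - v) =
        ProbabilityTheory.beta (a + 1) (b + 1) * truncPow (a + b + 1) (r - u) := by
    intro u
    have h := truncPow_convolution ha hb (r - u)
    constructor
    · have := h.1.comp_sub_right u
      simpa using this
    · rw [← h.2, ← integral_sub_right_eq_self (fun t => truncPow a t * truncPow b (r - u - t)) u]
      simp only [sub_sub_sub_cancel_right]
  have hprod : Integrable (fun z : ℝ × ℝ => F z.1 * truncPow a (z.2 - z.1) *
      truncPow b (r - z.2)) (volume.prod volume) := by
    rw [integrable_prod_iff]
    · refine ⟨.of_forall fun u => ?_, ?_⟩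
      · simpa only [mul_assoc] using (hsec u).1.const_mul (F u)
      · have : (fun u => ∫ v, ‖F u * truncPow a (v - u) * truncPow b (r - v)‖) = fun u =>
            ProbabilityTheory.beta (a + 1) (b + 1) *
              ‖F u * truncPow (a + b + 1) (r - u)‖ := by
          ext u
          simp only [norm_mul, Real.norm_of_nonneg (truncPow_nonneg _ _), mul_assoc]
          rw [integral_const_mul, (hsec u).2]
          ring
        rw [this]
        exact hFi.norm.const_mul _
    · exact (hF.comp_fst.mul (by fun_prop : Measurable _).aestronglyMeasurable).mul
        (by fun_prop : Measurable _).aestronglyMeasurable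
  constructor
  · have := hprod.integral_prod_right
    simpa only [integral_mul_const] using this
  · simp_rw [← integral_mul_const]
    rw [← integral_integral_swap (f := fun u v => F u * truncPow a (v - u) *
      truncPow b (r - v)) hprod, ← integral_const_mul]
    congr 1
    ext u
    simp only [mul_assoc]
    rw [integral_const_mul, (hsec u).2]
    ring

/-- A function whose primitive from `-∞` vanishes almost everywhere vanishes. -/
theorem ae_eq_zero_of_integral_Iio {F : ℝ → ℝ} (hF : ∀ r, IntegrableOn F (Set.Iio r))
    (h : ∀ᵐ r, ∫ u in Set.Iio r, F u = 0) : ∀ᵐ u, F u = 0 := by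
  have hloc : LocallyIntegrable F := fun x =>
    ⟨Set.Iio (x + 1), Iio_mem_nhds (by linarith), hF _⟩
  have hii : ∀ a b, IntervalIntegrable F volume a b := fun a b =>
    ((hF (max a b + 1)).mono_set fun x hx => by
      rw [Set.mem_Iio]; linarith [hx.2]).intervalIntegrable
  have hprim : ∀ r, ∫ u in (0 : ℝ)..r, F u =
      (∫ u in Set.Iio r, F u) - ∫ u in Set.Iio 0, F u := by
    intro r
    rw [← integral_Iic_eq_integral_Iio, ← integral_Iic_eq_integral_Iio,
      intervalIntegral.integral_Iic_sub_Iic]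
    · exact (hF (0 + 1)).mono_set (fun x hx => by simp at *; linarith)
    · exact (hF (r + 1)).mono_set (fun x hx => by simp at *; linarith)
  have hae : (fun r => ∫ u in (0 : ℝ)..r, F u) =ᵐ[volume]
      fun _ => - ∫ u in Set.Iio 0, F u := by
    filter_upwards [h] with r hr
    rw [hprim, hr, zero_sub]
  have heq := ((intervalIntegral.continuous_primitive hii 0).ae_eq_iff_eq volume
    continuous_const).1 hae
  filter_upwards [LocallyIntegrable.ae_hasDerivAt_integral hloc] with x hx
  have h1 := hx 0
  rw [heq] at h1
  exact h1.unique (hasDerivAt_const _ _)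

theorem integral_mul_truncPow_zero (F : ℝ → ℝ) (r : ℝ) :
    (fun u => F u * truncPow 0 (r - u)) = (Set.Iio r).indicator F := by
  ext u
  rcases lt_or_ge u r with h | h
  · rw [truncPow_of_pos (by linarith), Set.indicator_of_mem (Set.mem_Iio.2 h)]; simp
  · rw [truncPow_of_nonpos (by linarith), Set.indicator_of_notMem (by simpa using h)]; simp

theorem ae_eq_zero_of_integral_truncPow_zero {F : ℝ → ℝ}
    (hF : ∀ r, Integrable (fun u => F u * truncPow 0 (r - u)))
    (h : ∀ᵐ r, ∫ u, F u * truncPow 0 (r - u) = 0) : ∀ᵐ u, F u = 0 := by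
  simp_rw [integral_mul_truncPow_zero] at hF h
  simp_rw [integral_indicator measurableSet_Iio] at h
  exact ae_eq_zero_of_integral_Iio
    (fun r => (integrable_indicator_iff measurableSet_Iio).1 (hF r)) h

theorem truncPow_natCast_le (n : ℕ) (s : ℝ) :
    truncPow n s ≤ truncPow (n + 1) (s + 1) := by
  rcases le_or_gt s 0 with hs | hs
  · rw [truncPow_of_nonpos hs]; exact truncPow_nonneg _ _
  · rw [truncPow_of_pos hs, truncPow_of_pos (by linarith)]
    exact (Real.rpow_le_rpow hs.le (by linarith) (by positivity)).trans
      (Real.rpow_le_rpow_of_exponent_le (by linarith) (by linarith))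

theorem ae_eq_zero_of_integral_truncPow_natCast {F : ℝ → ℝ} (hm : AEStronglyMeasurable F)
    (n : ℕ) (hF : ∀ r, Integrable (fun u => F u * truncPow n (r - u)))
    (h : ∀ᵐ r, ∫ u, F u * truncPow n (r - u) = 0) : ∀ᵐ u, F u = 0 := by
  induction n with
  | zero => exact ae_eq_zero_of_integral_truncPow_zero (by simpa using hF) (by simpa using h)
  | succ n ih =>
    push_cast at hF h
    have key := fun r => integral_truncPow_comp hm (a := n) (b := 0)
      (by have : (0 : ℝ) ≤ n := n.cast_nonneg
          linarith) (by norm_num) r (by simpa using hF r)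
    refine ih (fun r => ?_) (ae_eq_zero_of_integral_truncPow_zero (fun r => (key r).1) ?_)
    · refine (hF (r + 1)).mono (hm.mul (by fun_prop : Measurable _).aestronglyMeasurable) (.of_forall fun u => ?_)
      simp only [norm_mul, Real.norm_of_nonneg (truncPow_nonneg _ _)]
      refine mul_le_mul_of_nonneg_left ?_ (norm_nonneg _)
      rw [show r + 1 - u = r - u + 1 by ring]
      exact truncPow_natCast_le n (r - u)
    · filter_upwards [h] with r hr
      rw [(key r).2]
      simp [hr]

/-- Injectivity of the one-sided fractional integral of order `a + 1`, for `2 a` an integer. -/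
theorem ae_eq_zero_of_integral_truncPow {F : ℝ → ℝ} (hm : AEStronglyMeasurable F)
    {a : ℝ} (ha : -1 < a) (n : ℕ) (hn : a + a + 1 = n)
    (hF : ∀ r, Integrable (fun u => F u * truncPow n (r - u)))
    (h : ∀ᵐ r, ∫ u, F u * truncPow a (r - u) = 0) : ∀ᵐ u, F u = 0 := by
  refine ae_eq_zero_of_integral_truncPow_natCast hm n hF (.of_forall fun r => ?_)
  have key := (integral_truncPow_comp hm ha ha r (by rw [hn]; exact hF r)).2
  have h0 : ProbabilityTheory.beta (a + 1) (a + 1) ≠ 0 :=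
    (ProbabilityTheory.beta_pos (by linarith) (by linarith)).ne'
  rw [hn, integral_eq_zero_of_ae] at key
  · simpa [h0] using key.symm
  · filter_upwards [h] with v hv
    simp [hv]

open scoped Pointwise in
theorem volume_sum_sq_lt (d : ℕ) :
    ∃ c : ℝ, 0 < c ∧ ∀ ρ : ℝ, volume {x : Fin d → ℝ | ∑ j, x j ^ 2 < ρ} =
      ENNReal.ofReal (c * truncPow ((d : ℝ) / 2) ρ) := by
  have hcont : Continuous fun x : Fin d → ℝ => ∑ j, x j ^ 2 := by fun_prop
  have hpos : 0 < volume {x : Fin d → ℝ | ∑ j, x j ^ 2 < 1} :=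
    (isOpen_lt hcont continuous_const).measure_pos volume ⟨0, by simp⟩
  have hfin : volume {x : Fin d → ℝ | ∑ j, x j ^ 2 < 1} < ⊤ := by
    refine (measure_mono ?_).trans_lt (measure_Icc_lt_top (a := fun _ : Fin d => (-1 : ℝ))
      (b := fun _ => 1))
    intro x hx
    have h : ∀ j, |x j| ≤ 1 := fun j => by
      rw [← sq_le_one_iff_abs_le_one]
      exact (Finset.single_le_sum (fun i _ => sq_nonneg (x i)) (Finset.mem_univ j)).trans
        (le_of_lt hx)
    exact ⟨fun j => (abs_le.1 (h j)).1, fun j => (abs_le.1 (h j)).2⟩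
  refine ⟨_, ENNReal.toReal_pos hpos.ne' hfin.ne, fun ρ => ?_⟩
  rcases le_or_gt ρ 0 with hρ | hρ
  · have : {x : Fin d → ℝ | ∑ j, x j ^ 2 < ρ} = ∅ := by
      ext x
      simpa using hρ.trans (Finset.sum_nonneg fun j _ => sq_nonneg (x j))
    rw [this, truncPow_of_nonpos hρ]
    simp
  · have hs : 0 < √ρ := Real.sqrt_pos.2 hρ
    have : {x : Fin d → ℝ | ∑ j, x j ^ 2 < ρ} =
        √ρ • {x : Fin d → ℝ | ∑ j, x j ^ 2 < 1} := by
      ext x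
      rw [Set.mem_smul_set_iff_inv_smul_mem₀ hs.ne']
      simp only [Set.mem_ofPred_eq, Pi.smul_apply, smul_eq_mul, mul_pow, ← Finset.mul_sum,
        inv_pow, Real.sq_sqrt hρ.le]
      rw [inv_mul_lt_iff₀ hρ, mul_one]
    rw [this, Measure.addHaar_smul, truncPow_of_pos hρ, mul_comm (ENNReal.toReal _),
      ENNReal.ofReal_mul (by positivity), ENNReal.ofReal_toReal hfin.ne,
      Module.finrank_fin_fun, abs_of_pos (by positivity), Real.sqrt_eq_rpow,
      ← Real.rpow_mul_natCast hρ.le]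
    congr 3
    ring

theorem exp_neg_lt_gaussWeight_iff (d : ℕ) (s t : ℝ) (x : Fin d → ℝ) :
    Real.exp (-s) < gaussWeight d (t, x) ↔
      ∑ j, x j ^ 2 < 2 * (1 + t ^ 2) * (s - (d : ℝ) / 2 * Real.log (1 + t ^ 2)) := by
  have h : 0 < 1 + t ^ 2 := by positivity
  unfold gaussWeight
  simp only
  rw [Real.rpow_def_of_pos h, ← Real.exp_add, Real.exp_lt_exp, ← sub_pos,
    ← sub_pos (b := ∑ j, x j ^ 2),
    show Real.log (1 + t ^ 2) * (-(d : ℝ) / 2) + -(∑ j, x j ^ 2) / (2 * (1 + t ^ 2)) - -s =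
      (2 * (1 + t ^ 2) * (s - (d : ℝ) / 2 * Real.log (1 + t ^ 2)) - ∑ j, x j ^ 2) /
        (2 * (1 + t ^ 2)) by field_simp; ring]
  exact ⟨fun h' => by simpa [h] using (div_pos_iff_of_pos_right (by positivity)).1 h',
    fun h' => div_pos h' (by positivity)⟩

theorem gaussDist_exp_neg (d : ℕ) :
    ∃ c : ℝ, 0 < c ∧ ∀ s : ℝ, gaussDist d (Real.exp (-s)) =
      c * ∫ t : ℝ, (1 + t ^ 2) ^ ((d : ℝ) / 2) *
        truncPow ((d : ℝ) / 2) (s - (d : ℝ) / 2 * Real.log (1 + t ^ 2)) := by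
  obtain ⟨c, hc, hvol⟩ := volume_sum_sq_lt d
  refine ⟨c * 2 ^ ((d : ℝ) / 2), by positivity, fun s => ?_⟩
  have hmeas : MeasurableSet {p : ℝ × (Fin d → ℝ) | Real.exp (-s) < gaussWeight d p} := by
    refine measurableSet_lt measurable_const ?_
    unfold gaussWeight
    fun_prop
  unfold gaussDist
  rw [Measure.volume_eq_prod, Measure.prod_apply hmeas, ← integral_const_mul,
    integral_eq_lintegral_of_nonneg_ae]
  · congr 1
    refine lintegral_congr fun t => ?_
    simp only [Set.preimage_ofPred_eq, exp_neg_lt_gaussWeight_iff]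
    have h : 0 < 1 + t ^ 2 := by positivity
    rw [hvol, truncPow_mul (by positivity), Real.mul_rpow (by norm_num) h.le]
    ring_nf
  · refine .of_forall fun t => ?_
    have := truncPow_nonneg ((d : ℝ) / 2) (s - (d : ℝ) / 2 * Real.log (1 + t ^ 2))
    simp only [Pi.zero_apply]
    positivity
  · exact (by fun_prop : Measurable _).aestronglyMeasurable

theorem integrable_exp_mul_truncPow {g b : ℝ} (hg : 0 < g) (hb : -1 < b) (r : ℝ) :
    Integrable (fun u => Real.exp (g * u) * truncPow b (r - u)) ∧
      ∫ u, Real.exp (g * u) * truncPow b (r - u) =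
        Real.exp (g * r) * ∫ s, Real.exp (-(g * s)) * truncPow b s := by
  have h0 : Integrable (fun s => Real.exp (-(g * s)) * truncPow b s) := by
    have h := integrableOn_rpow_mul_exp_neg_mul_rpow hb one_pos hg
    rw [← integrable_indicator_iff measurableSet_Ioi] at h
    refine h.congr (.of_forall fun s => ?_)
    rcases le_or_gt s 0 with hs | hs
    · simp [truncPow_of_nonpos hs, hs]
    · simp [truncPow_of_pos hs, hs, mul_comm]
  have heq : (fun u => Real.exp (g * u) * truncPow b (r - u)) = fun u => Real.exp (g * r) *
      (Real.exp (-(g * (r - u))) * truncPow b (r - u)) := by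
    ext u
    rw [← mul_assoc, ← Real.exp_add]
    ring_nf
  rw [heq]
  exact ⟨(h0.comp_sub_left r).const_mul _, by
    rw [integral_const_mul,
      integral_sub_left_eq_self (fun s => Real.exp (-(g * s)) * truncPow b s) volume r]⟩

theorem norm_mul_truncPow_le {F : ℝ → ℝ} {g K r : ℝ}
    (hK : ∀ u ≤ r, |F u| ≤ K * Real.exp (g * u)) (b : ℝ) {s : ℝ} (hs : s ≤ r) (u : ℝ) :
    ‖F u * truncPow b (s - u)‖ ≤ K * (Real.exp (g * u) * truncPow b (s - u)) := by
  rw [norm_mul, Real.norm_of_nonneg (truncPow_nonneg _ _), ← mul_assoc, Real.norm_eq_abs]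
  rcases le_or_gt (s - u) 0 with h | h
  · simp [truncPow_of_nonpos h]
  · exact mul_le_mul_of_nonneg_right (hK u (by linarith)) (truncPow_nonneg _ _)

theorem integrable_mul_truncPow {F : ℝ → ℝ} (hF : Continuous F) {g : ℝ} (hg : 0 < g)
    (hbd : ∀ r, ∃ K, ∀ u ≤ r, |F u| ≤ K * Real.exp (g * u)) {b : ℝ} (hb : -1 < b) (r : ℝ) :
    Integrable (fun u => F u * truncPow b (r - u)) := by
  obtain ⟨K, hK⟩ := hbd r
  exact ((integrable_exp_mul_truncPow hg hb r).1.const_mul K).mono'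
    (by fun_prop : Measurable _).aestronglyMeasurable
    (.of_forall fun u => norm_mul_truncPow_le hK b le_rfl u)

theorem integral_norm_mul_truncPow_le {F : ℝ → ℝ} (hF : Continuous F) {g : ℝ} (hg : 0 < g)
    (hbd : ∀ r, ∃ K, ∀ u ≤ r, |F u| ≤ K * Real.exp (g * u)) {b : ℝ} (hb : -1 < b) (r : ℝ) :
    ∃ K, ∀ s ≤ r, ∫ u, ‖F u * truncPow b (s - u)‖ ≤ K * Real.exp (g * s) := by
  obtain ⟨K, hK⟩ := hbd r
  refine ⟨K * ∫ s, Real.exp (-(g * s)) * truncPow b s, fun s hs => ?_⟩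
  refine (integral_mono (integrable_mul_truncPow hF hg hbd hb s).norm
    ((integrable_exp_mul_truncPow hg hb s).1.const_mul K)
    (fun u => norm_mul_truncPow_le hK b hs u)).trans_eq ?_
  rw [integral_const_mul, (integrable_exp_mul_truncPow hg hb s).2]
  ring

theorem one_add_sq_rpow_mul_exp (d : ℕ) (hd : 1 ≤ d) (t : ℝ) :
    (1 + t ^ 2) ^ ((d : ℝ) / 2) *
      Real.exp (-((1 + 2 / (d : ℝ)) * ((d : ℝ) / 2 * Real.log (1 + t ^ 2)))) =
      (1 + t ^ 2)⁻¹ := by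
  have h : 0 < 1 + t ^ 2 := by positivity
  have hd' : (d : ℝ) ≠ 0 := by positivity
  rw [Real.rpow_def_of_pos h, ← Real.exp_add, ← Real.exp_log h, Real.log_exp,
    ← Real.exp_neg]
  congr 1
  field_simp
  ring

/-- Fubini: testing `F` against the distribution function averages its fractional integral. -/
theorem integral_mul_integral_truncPow {d : ℕ} (hd : 1 ≤ d) {F : ℝ → ℝ} (hF : Continuous F)
    (hbd : ∀ r, ∃ K, ∀ u ≤ r, |F u| ≤ K * Real.exp ((1 + 2 / (d : ℝ)) * u)) (r : ℝ) :
    ∫ u, F u * ∫ t : ℝ, (1 + t ^ 2) ^ ((d : ℝ) / 2) *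
        truncPow ((d : ℝ) / 2) (r - u - (d : ℝ) / 2 * Real.log (1 + t ^ 2)) =
      ∫ t : ℝ, (1 + t ^ 2) ^ ((d : ℝ) / 2) *
        ∫ u, F u * truncPow ((d : ℝ) / 2) (r - (d : ℝ) / 2 * Real.log (1 + t ^ 2) - u) := by
  have hg : 0 < 1 + 2 / (d : ℝ) := by positivity
  have hb : -1 < (d : ℝ) / 2 := by linarith [show (0 : ℝ) ≤ (d : ℝ) / 2 by positivity]
  have hsec : ∀ t : ℝ, (fun u => F u * ((1 + t ^ 2) ^ ((d : ℝ) / 2) *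
      truncPow ((d : ℝ) / 2) (r - u - (d : ℝ) / 2 * Real.log (1 + t ^ 2)))) =
      fun u => (1 + t ^ 2) ^ ((d : ℝ) / 2) *
        (F u * truncPow ((d : ℝ) / 2) (r - (d : ℝ) / 2 * Real.log (1 + t ^ 2) - u)) := by
    intro t
    ext u
    rw [sub_right_comm]
    ring
  have hmeas : Measurable (fun z : ℝ × ℝ => F z.1 * ((1 + z.2 ^ 2) ^ ((d : ℝ) / 2) *
      truncPow ((d : ℝ) / 2) (r - z.1 - (d : ℝ) / 2 * Real.log (1 + z.2 ^ 2)))) := by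
    fun_prop
  have hprod : Integrable (fun z : ℝ × ℝ => F z.1 * ((1 + z.2 ^ 2) ^ ((d : ℝ) / 2) *
      truncPow ((d : ℝ) / 2) (r - z.1 - (d : ℝ) / 2 * Real.log (1 + z.2 ^ 2))))
      (volume.prod volume) := by
    rw [integrable_prod_iff' hmeas.aestronglyMeasurable]
    constructor
    · refine .of_forall fun t => ?_
      simp only
      rw [hsec]
      exact (integrable_mul_truncPow hF hg hbd hb _).const_mul _
    · obtain ⟨K, hK⟩ := integral_norm_mul_truncPow_le hF hg hbd hb r
      refine (integrable_inv_one_add_sq.const_mul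
        (K * Real.exp ((1 + 2 / (d : ℝ)) * r))).mono' ?_ (.of_forall fun t => ?_)
      · exact hmeas.aestronglyMeasurable.norm.prod_swap.integral_prod_right'
      · have h1 : 0 ≤ (1 + t ^ 2) ^ ((d : ℝ) / 2) := by positivity
        have h2 : 0 ≤ (d : ℝ) / 2 * Real.log (1 + t ^ 2) :=
          mul_nonneg (by positivity) (Real.log_nonneg (by nlinarith [sq_nonneg t]))
        have h3 := congrArg (fun f : ℝ → ℝ => ∫ u, ‖f u‖) (hsec t)
        simp only at h3 ⊢
        rw [Real.norm_of_nonneg (integral_nonneg fun u => norm_nonneg _), h3]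
        simp_rw [norm_mul ((1 + t ^ 2) ^ ((d : ℝ) / 2)), Real.norm_of_nonneg h1]
        rw [integral_const_mul]
        refine (mul_le_mul_of_nonneg_left (hK _ (by linarith)) h1).trans_eq ?_
        rw [mul_sub, sub_eq_add_neg, Real.exp_add, ← one_add_sq_rpow_mul_exp d hd]
        ring
  simp_rw [← integral_const_mul]
  rw [integral_integral_swap hprod]
  simp_rw [hsec]

theorem image_div_one_add_sq {r : ℝ} (hr : 0 < r) :
    (fun t : ℝ => r / (1 + t ^ 2)) '' Set.Ioi 0 = Set.Ioo 0 r := by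
  ext u
  constructor
  · rintro ⟨t, ht, rfl⟩
    have ht' : 0 < t := ht
    refine ⟨by positivity, ?_⟩
    rw [div_lt_iff₀ (by positivity)]
    nlinarith [mul_pos hr (pow_pos ht' 2)]
  · rintro ⟨h0, hu⟩
    have h1 : 0 < r / u - 1 := by rw [sub_pos, lt_div_iff₀ h0]; linarith
    refine ⟨√(r / u - 1), Real.sqrt_pos.2 h1, ?_⟩
    simp only [Real.sq_sqrt h1.le, add_sub_cancel]
    field_simp

/-- The substitution `u = r / (1 + t²)` turning the average over time into an Abel integral. -/
theorem integral_Ioi_comp_div_one_add_sq (a : ℝ) (f : ℝ → ℝ) {r : ℝ} (hr : 0 < r) :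
    ∫ u in Set.Ioo 0 r, u ^ (-a - 3 / 2) * f (Real.log u) * (r - u) ^ (-(1 / 2) : ℝ) =
      2 * r ^ (-a - 1) * ∫ t in Set.Ioi (0 : ℝ), (1 + t ^ 2) ^ a *
        f (Real.log r - Real.log (1 + t ^ 2)) := by
  have hderiv : ∀ t ∈ Set.Ioi (0 : ℝ), HasDerivWithinAt (fun t : ℝ => r / (1 + t ^ 2))
      (-(2 * r * t) / (1 + t ^ 2) ^ 2) (Set.Ioi 0) t := by
    intro t _
    have h : 1 + t ^ 2 ≠ 0 := by positivity
    have := (hasDerivAt_const t r).div ((hasDerivAt_pow 2 t).const_add 1) h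
    refine HasDerivAt.hasDerivWithinAt (this.congr_deriv ?_)
    push_cast
    ring
  have hinj : Set.InjOn (fun t : ℝ => r / (1 + t ^ 2)) (Set.Ioi 0) := by
    intro s hs t ht h
    have hs' : 0 < s := hs
    have ht' : 0 < t := ht
    simp only at h
    rw [div_eq_div_iff (by positivity) (by positivity)] at h
    have := mul_left_cancel₀ hr.ne' h
    exact (pow_left_inj₀ hs'.le ht'.le two_ne_zero).1 (by linarith)
  rw [← image_div_one_add_sq hr, integral_image_eq_integral_abs_deriv_smul measurableSet_Ioi
    hderiv hinj, ← integral_const_mul]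
  refine setIntegral_congr_fun measurableSet_Ioi fun t ht => ?_
  have ht' : 0 < t := ht
  have hq : 0 < 1 + t ^ 2 := by positivity
  have hsub : r - r / (1 + t ^ 2) = r * t ^ 2 / (1 + t ^ 2) := by field_simp; ring
  simp only [smul_eq_mul]
  rw [hsub, Real.log_div hr.ne' hq.ne', abs_div, abs_neg, abs_of_pos (by positivity),
    abs_of_pos (by positivity)]
  have key : 2 * r * t / (1 + t ^ 2) ^ 2 * ((r / (1 + t ^ 2)) ^ (-a - 3 / 2) *
      (r * t ^ 2 / (1 + t ^ 2)) ^ (-(1 / 2) : ℝ)) = 2 * r ^ (-a - 1) * (1 + t ^ 2) ^ a := by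
    rw [Real.rpow_def_of_pos (by positivity), Real.rpow_def_of_pos (by positivity),
      Real.rpow_def_of_pos hr, Real.rpow_def_of_pos hq, Real.log_div (by positivity) hq.ne',
      Real.log_div (by positivity) hq.ne', Real.log_mul hr.ne' (by positivity), Real.log_pow]
    have hfrac : 2 * r * t / (1 + t ^ 2) ^ 2 = 2 * Real.exp (Real.log r + Real.log t -
        2 * Real.log (1 + t ^ 2)) := by
      rw [two_mul (Real.log (1 + t ^ 2)), Real.exp_sub, Real.exp_add, Real.exp_add,
        Real.exp_log hr, Real.exp_log ht', Real.exp_log hq]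
      ring
    rw [hfrac, mul_assoc, mul_assoc, ← Real.exp_add, ← Real.exp_add, ← Real.exp_add]
    congr 2
    push_cast
    ring
  linear_combination f (Real.log r - Real.log (1 + t ^ 2)) * key

theorem ae_comp_mul_log_of_ae {P : ℝ → Prop} {a : ℝ} (ha : a ≠ 0)
    (h : ∀ᵐ u : ℝ, 0 < u → P (a * Real.log u)) : ∀ᵐ y, P y := by
  rw [ae_iff] at h ⊢
  refine measure_mono_null (fun y hy => ?_)
    (addHaar_image_eq_zero_of_differentiableOn_of_addHaar_eq_zero volume
      (f := fun u => a * Real.log u) (fun u hu => ?_) h)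
  · refine ⟨Real.exp (y / a), ?_, ?_⟩
    · simp only [Set.mem_ofPred_eq, Real.log_exp, mul_div_cancel₀ _ ha]
      exact fun h' => hy (h' (Real.exp_pos _))
    · simp only [Real.log_exp]
      field_simp
  · have hu' : 0 < u := by
      by_contra h'
      exact hu fun h'' => absurd h'' h'
    exact ((Real.differentiableAt_log hu'.ne').const_mul a).differentiableWithinAt

/-- Injectivity of averaging over time against `(1 + t²) ^ (d / 2)`. -/
theorem ae_eq_zero_of_integral_one_add_sq {d : ℕ} (hd : 1 ≤ d) {f : ℝ → ℝ} (hf : Measurable f)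
    (hbd : ∀ r, ∃ K, ∀ u ≤ r, |f u| ≤ K * Real.exp ((1 + 2 / (d : ℝ)) * u))
    (h : ∀ r, ∫ t : ℝ, (1 + t ^ 2) ^ ((d : ℝ) / 2) *
      f (r - (d : ℝ) / 2 * Real.log (1 + t ^ 2)) = 0) : ∀ᵐ u, f u = 0 := by
  have hd' : (0 : ℝ) < d := by positivity
  set a : ℝ := (d : ℝ) / 2 with ha
  set G : ℝ → ℝ := (Set.Ioi (0 : ℝ)).indicator
    (fun u => u ^ (-a - 3 / 2) * f (a * Real.log u)) with hG
  have hGm : Measurable G := Measurable.indicator (by fun_prop) measurableSet_Ioi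
  have hG0 : ∀ u ≤ 0, G u = 0 := fun u hu => Set.indicator_of_notMem (by simpa using hu) _
  have hG1 : ∀ u, 0 < u → G u = u ^ (-a - 3 / 2) * f (a * Real.log u) :=
    fun u hu => Set.indicator_of_mem (Set.mem_Ioi.2 hu) _
  have hzero : ∀ b r : ℝ, r ≤ 0 → ∀ u, G u * truncPow b (r - u) = 0 := by
    intro b r hr u
    rcases le_or_gt u 0 with hu | hu
    · rw [hG0 u hu, zero_mul]
    · rw [truncPow_of_nonpos (by linarith), mul_zero]
  have hGae : ∀ᵐ u, G u = 0 := by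
    refine ae_eq_zero_of_integral_truncPow hGm.aestronglyMeasurable (a := -(1 / 2))
      (by norm_num) 0 (by norm_num) (fun r => ?_) (.of_forall fun r => ?_)
    · rcases le_or_gt r 0 with hr | hr
      · simp [hzero _ r hr]
      obtain ⟨K, hK⟩ := hbd (a * Real.log r)
      refine (((truncPow_convolution (a := -(1 / 2)) (b := 0) (by norm_num) (by norm_num)
        r).1).const_mul K).mono' (by fun_prop : Measurable _).aestronglyMeasurable
        (.of_forall fun u => ?_)
      rcases le_or_gt u 0 with hu | hu
      · rw [hG0 u hu, truncPow_of_nonpos hu]; simp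
      rcases le_or_gt (r - u) 0 with hur | hur
      · rw [truncPow_of_nonpos (by simpa using hur), truncPow_of_nonpos hur]; simp
      rw [hG1 u hu, truncPow_of_pos hu, Nat.cast_zero, norm_mul, norm_mul,
        Real.norm_of_nonneg (truncPow_nonneg _ _), ← mul_assoc,
        Real.norm_of_nonneg (by positivity : 0 ≤ u ^ (-a - 3 / 2))]
      refine mul_le_mul_of_nonneg_right ?_ (truncPow_nonneg _ _)
      have h1 := hK (a * Real.log u) (mul_le_mul_of_nonneg_left
        (Real.log_le_log hu (by linarith)) (by positivity))
      refine (mul_le_mul_of_nonneg_left h1 (by positivity)).trans_eq ?_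
      rw [mul_left_comm]
      congr 1
      rw [Real.rpow_def_of_pos hu, Real.rpow_def_of_pos hu, ← Real.exp_add, ha]
      congr 1
      field_simp
      ring
    · rcases le_or_gt r 0 with hr | hr
      · simp [hzero _ r hr]
      have heq : (fun u => G u * truncPow (-(1 / 2)) (r - u)) = (Set.Ioo 0 r).indicator
          (fun u => u ^ (-a - 3 / 2) * f (a * Real.log u) * (r - u) ^ (-(1 / 2) : ℝ)) := by
        ext u
        rcases le_or_gt u 0 with hu | hu
        · rw [hG0 u hu, Set.indicator_of_notMem (fun h' => absurd h'.1 (not_lt.2 hu)), zero_mul]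
        rcases le_or_gt r u with hur | hur
        · rw [truncPow_of_nonpos (by linarith),
            Set.indicator_of_notMem (fun h' => absurd h'.2 (not_lt.2 hur)), mul_zero]
        · rw [hG1 u hu, truncPow_of_pos (by linarith), Set.indicator_of_mem (Set.mem_Ioo.2 ⟨hu, hur⟩)]
      rw [heq, integral_indicator measurableSet_Ioo,
        integral_Ioi_comp_div_one_add_sq a (fun y => f (a * y)) hr]
      have h2 := integral_comp_abs (f := fun t : ℝ => (1 + t ^ 2) ^ a *
        f (a * (Real.log r - Real.log (1 + t ^ 2))))
      simp only [sq_abs, mul_sub, h (a * Real.log r)] at h2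
      simp only [mul_sub]
      rw [show ∫ t in Set.Ioi (0 : ℝ), (1 + t ^ 2) ^ a *
        f (a * Real.log r - a * Real.log (1 + t ^ 2)) = 0 by linarith, mul_zero]
  refine ae_comp_mul_log_of_ae (a := a) (by positivity) ?_
  filter_upwards [hGae] with u hu hu0
  rw [hG1 u hu0] at hu
  exact (mul_eq_zero.1 hu).resolve_left (by positivity)

theorem eq_zero_of_integral_mul_gaussDist {d : ℕ} (hd : 1 ≤ d) {F : ℝ → ℝ} (hF : Continuous F)
    (hbd : ∀ r, ∃ K, ∀ u ≤ r, |F u| ≤ K * Real.exp ((1 + 2 / (d : ℝ)) * u))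
    (h : ∀ r, ∫ u, F u * gaussDist d (Real.exp (-(r - u))) = 0) : F = 0 := by
  have hg : 0 < 1 + 2 / (d : ℝ) := by positivity
  have hd0 : (0 : ℝ) ≤ d := by positivity
  have hb : -1 < (d : ℝ) / 2 := by linarith
  obtain ⟨c, hc, hdist⟩ := gaussDist_exp_neg d
  have hΦ : ∀ᵐ r, ∫ u, F u * truncPow ((d : ℝ) / 2) (r - u) = 0 := by
    refine ae_eq_zero_of_integral_one_add_sq hd ?_ (fun r => ?_) (fun r => ?_)
    · exact (by fun_prop : Measurable fun z : ℝ × ℝ =>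
        F z.2 * truncPow ((d : ℝ) / 2) (z.1 - z.2)).stronglyMeasurable.integral_prod_right'.measurable
    · obtain ⟨K, hK⟩ := integral_norm_mul_truncPow_le hF hg hbd hb r
      exact ⟨K, fun s hs => (norm_integral_le_integral_norm _).trans (hK s hs)⟩
    · rw [← integral_mul_integral_truncPow hd hF hbd r]
      have h1 := h r
      simp_rw [hdist, mul_left_comm _ c] at h1
      rw [integral_const_mul] at h1
      exact (mul_eq_zero.1 h1).resolve_left hc.ne'
  have hae : F =ᵐ[volume] 0 := ae_eq_zero_of_integral_truncPow hF.aestronglyMeasurable hb (d + 1)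
    (by push_cast; ring) (fun r => integrable_mul_truncPow hF hg hbd
      (by push_cast; linarith) r) hΦ
  exact (hF.ae_eq_iff_eq volume continuous_const).1 hae

/-- If `g₁, g₂` are continuous on `[0,∞)`, vanish at `0`, are `C¹`
on `(0,∞)` with intercritical bounds on the derivative, `hⱼ(k) = e^{-k} gⱼ'(e^{-k})`,
and `∫_{-a}^∞ (h₁(k) − h₂(k)) μ(e^{-(k+a)}) dk = 0` for every `a`, then `g₁ = g₂`
on `[0,∞)`. -/
theorem deconvolution_determines_g (d : ℕ) (hd : 1 ≤ d) (p₁ : ℝ)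
    (hp₁ : 4 / (d : ℝ) < p₁) (C : ℝ) (g₁ g₂ : ℝ → ℝ)
    (hgc₁ : ContinuousOn g₁ (Set.Ici 0)) (hgc₂ : ContinuousOn g₂ (Set.Ici 0))
    (hg₁0 : g₁ 0 = 0) (hg₂0 : g₂ 0 = 0)
    (hgd₁ : ∀ l : ℝ, 0 < l → DifferentiableAt ℝ g₁ l)
    (hgd₂ : ∀ l : ℝ, 0 < l → DifferentiableAt ℝ g₂ l)
    (hgd₁' : ContinuousOn (deriv g₁) (Set.Ioi 0))
    (hgd₂' : ContinuousOn (deriv g₂) (Set.Ioi 0))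
    (hgb₁ : ∀ l : ℝ, 0 < l → |deriv g₁ l| ≤ C * (l ^ (2 / (d : ℝ)) + l ^ (p₁ / 2)))
    (hgb₂ : ∀ l : ℝ, 0 < l → |deriv g₂ l| ≤ C * (l ^ (2 / (d : ℝ)) + l ^ (p₁ / 2)))
    (hconv : ∀ a : ℝ,
      (∫ k in Set.Ioi (-a),
        (Real.exp (-k) * deriv g₁ (Real.exp (-k)) -
          Real.exp (-k) * deriv g₂ (Real.exp (-k))) *
          gaussDist d (Real.exp (-(k + a)))) = 0) :
    ∀ l : ℝ, 0 ≤ l → g₁ l = g₂ l := by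
  have hd0 : (0 : ℝ) < d := by positivity
  set F : ℝ → ℝ := fun u => Real.exp u * deriv g₁ (Real.exp u) -
    Real.exp u * deriv g₂ (Real.exp u) with hFdef
  have hF : Continuous F := by
    have h₁ : Continuous fun u => deriv g₁ (Real.exp u) :=
      hgd₁'.comp_continuous Real.continuous_exp fun u => Real.exp_pos u
    have h₂ : Continuous fun u => deriv g₂ (Real.exp u) :=
      hgd₂'.comp_continuous Real.continuous_exp fun u => Real.exp_pos u
    exact (Real.continuous_exp.mul h₁).sub (Real.continuous_exp.mul h₂)
  have hC : 0 ≤ C := by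
    have := (abs_nonneg _).trans (hgb₁ 1 one_pos)
    simp only [Real.one_rpow] at this
    linarith
  have hgap : 0 < p₁ / 2 - 2 / (d : ℝ) := by
    have : 4 / (d : ℝ) = 2 * (2 / d) := by ring
    linarith
  have hbd : ∀ r, ∃ K, ∀ u ≤ r, |F u| ≤ K * Real.exp ((1 + 2 / (d : ℝ)) * u) := by
    intro r
    refine ⟨2 * C * (1 + Real.exp ((p₁ / 2 - 2 / (d : ℝ)) * r)), fun u hu => ?_⟩
    have hle : Real.exp u ^ (2 / (d : ℝ)) + Real.exp u ^ (p₁ / 2) ≤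
        Real.exp (2 / (d : ℝ) * u) * (1 + Real.exp ((p₁ / 2 - 2 / (d : ℝ)) * r)) := by
      rw [← Real.exp_mul, ← Real.exp_mul, mul_add, mul_one, mul_comm u, ← Real.exp_add]
      gcongr
      nlinarith
    calc |F u| = Real.exp u * |deriv g₁ (Real.exp u) - deriv g₂ (Real.exp u)| := by
          simp only [hFdef]
          rw [← mul_sub, abs_mul, abs_of_pos (Real.exp_pos u)]
      _ ≤ Real.exp u * (|deriv g₁ (Real.exp u)| + |deriv g₂ (Real.exp u)|) := by
          gcongr
          exact abs_sub _ _
      _ ≤ Real.exp u * (2 * C * (Real.exp (2 / (d : ℝ) * u) *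
            (1 + Real.exp ((p₁ / 2 - 2 / (d : ℝ)) * r)))) := by
          gcongr
          have h := mul_le_mul_of_nonneg_left hle hC
          linarith [hgb₁ _ (Real.exp_pos u), hgb₂ _ (Real.exp_pos u)]
      _ = _ := by
          rw [add_mul, one_mul, Real.exp_add]
          ring
  have hF0 : F = 0 := by
    refine eq_zero_of_integral_mul_gaussDist hd hF hbd fun r => ?_
    obtain ⟨c, -, hdist⟩ := gaussDist_exp_neg d
    have hvanish : ∀ s ≤ 0, gaussDist d (Real.exp (-s)) = 0 := by
      intro s hs
      have h0 : ∀ t : ℝ, truncPow ((d : ℝ) / 2) (s - (d : ℝ) / 2 * Real.log (1 + t ^ 2)) = 0 := by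
        intro t
        have := mul_nonneg (by positivity : 0 ≤ (d : ℝ) / 2)
          (Real.log_nonneg (by nlinarith [sq_nonneg t] : 1 ≤ 1 + t ^ 2))
        exact truncPow_of_nonpos (by linarith)
      simp [hdist, h0]
    rw [← integral_neg_eq_self, ← hconv r, ← integral_indicator measurableSet_Ioi]
    congr 1
    ext k
    rw [sub_neg_eq_add, add_comm r k]
    rcases le_or_gt k (-r) with hk | hk
    · rw [Set.indicator_of_notMem (by simpa using hk), hvanish _ (by linarith), mul_zero]
    · rw [Set.indicator_of_mem (Set.mem_Ioi.2 hk)]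
  have hderiv : ∀ l : ℝ, 0 < l → deriv g₁ l = deriv g₂ l := by
    intro l hl
    have h := congrFun hF0 (Real.log l)
    simp only [hFdef, Real.exp_log hl, Pi.zero_apply, ← mul_sub] at h
    exact sub_eq_zero.1 ((mul_eq_zero.1 h).resolve_left hl.ne')
  intro l hl
  rcases hl.eq_or_lt with rfl | hl
  · rw [hg₁0, hg₂0]
  obtain ⟨x, hx, hslope⟩ := exists_deriv_eq_slope (fun y => g₁ y - g₂ y) hl
    ((hgc₁.sub hgc₂).mono Set.Icc_subset_Ici_self)
    (fun y hy => ((hgd₁ y hy.1).sub (hgd₂ y hy.1)).differentiableWithinAt)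
  rw [show deriv (fun y => g₁ y - g₂ y) x = deriv g₁ x - deriv g₂ x from
    deriv_sub (hgd₁ x hx.1) (hgd₂ x hx.1), hderiv x hx.1, sub_self, hg₁0, hg₂0, sub_zero,
    sub_zero, sub_zero, eq_comm, div_eq_zero_iff] at hslope
  exact sub_eq_zero.1 (hslope.resolve_right hl.ne')
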